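/- In the sparse regime of the sparse positive-dependence detection problem, the hypotheses merge asymptotically: if ε_n = n^{-β} with β ∈ (1/2,1) fixed and ρ_n = 1 − n^{-γ} with γ > 0 fixed such that γ < 4(β − 1/2), then the total variation distance between the n-fold product measure of N(0,Σ_0) and the n-fold product measure of P_{ε_n,ρ_n} tends to 0 as n → ∞; consequently every sequence of tests (in particular the likelihood ratio test) is asymptotically powerless. -/

import Mathlib

open MeasureTheory ProbabilityTheory Real Filter Topology

noncomputable section

/-- The standard normal distribution on ℝ. -/
def stdGauss : Measure ℝ := gaussianReal 0 1

/-- Two independent standard normals. -/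
def stdGauss2 : Measure (ℝ × ℝ) := stdGauss.prod stdGauss

/-- `N(0, Σ_ρ)`: the centered bivariate normal with unit marginal variances and
correlation `ρ`, i.e. the law of `(Z₁, ρ Z₁ + √(1-ρ²) Z₂)` for independent standard
normal `Z₁, Z₂`. -/
def biNormal (ρ : ℝ) : Measure (ℝ × ℝ) :=
  stdGauss2.map fun z => (z.1, ρ * z.1 + Real.sqrt (1 - ρ ^ 2) * z.2)

/-- The contamination mixture `P_{ε,ρ} = (1-ε) N(0,Σ₀) + ε N(0,Σ_ρ)`. -/
def mixture (ε ρ : ℝ) : Measure (ℝ × ℝ) :=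
  ENNReal.ofReal (1 - ε) • biNormal 0 + ENNReal.ofReal ε • biNormal ρ

/-- The `n`-fold product (i.i.d.) measure. -/
def iid (n : ℕ) (μ : Measure (ℝ × ℝ)) : Measure (Fin n → ℝ × ℝ) :=
  Measure.pi fun _ => μ
/-- Total variation distance between two measures. -/
def tvDist {Ω : Type*} [MeasurableSpace Ω] (μ ν : Measure Ω) : ℝ :=
  ⨆ s : {s : Set Ω // MeasurableSet s}, |(μ s.1).toReal - (ν s.1).toReal|

lemma one_add_half_sub_le_sqrt {x p : ℝ} (hx : -1 ≤ x) (hp1 : 1 ≤ p) (hp2 : p ≤ 2) :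
    1 + x / 2 - |x| ^ p ≤ √(1 + x) := by
  rcases le_or_gt |x| 1 with h | h
  · have h1 : x ^ 2 ≤ |x| ^ p := by
      rw [← sq_abs, ← Real.rpow_natCast |x| 2]
      exact Real.rpow_le_rpow_of_exponent_ge' (abs_nonneg x) h (by linarith) (by simpa using hp2)
    have h2 : 1 + x / 2 - x ^ 2 / 2 ≤ √(1 + x) := by
      have hu := Real.sqrt_nonneg (1 + x)
      have hxu : x = √(1 + x) ^ 2 - 1 := by rw [Real.sq_sqrt (by linarith)]; ring
      generalize √(1 + x) = u at hu hxu
      subst hxu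
      nlinarith [mul_nonneg (sq_nonneg (u - 1)) (by positivity : 0 ≤ u ^ 2 + 2 * u)]
    nlinarith [sq_nonneg x]
  · have hx1 : 1 < x := by
      rcases abs_cases x with ⟨h1, _⟩ | ⟨h1, _⟩ <;> linarith
    have h1 : x ≤ |x| ^ p := by
      calc x ≤ |x| ^ (1 : ℝ) := by simpa using le_abs_self x
        _ ≤ |x| ^ p := Real.rpow_le_rpow_of_exponent_le h.le hp1
    have h2 : 1 ≤ √(1 + x) := Real.one_le_sqrt.mpr (by linarith)
    linarith

lemma abs_sub_one_rpow_le {l p : ℝ} (hl : 0 ≤ l) (hp : 0 ≤ p) : |l - 1| ^ p ≤ l ^ p + 1 := by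
  rcases le_or_gt 1 l with h | h
  · have : |l - 1| ^ p ≤ l ^ p :=
      Real.rpow_le_rpow (abs_nonneg _) (by rw [abs_of_nonneg] <;> linarith) hp
    linarith
  · have : |l - 1| ^ p ≤ 1 :=
      Real.rpow_le_one (abs_nonneg _) (by rw [abs_of_neg] <;> linarith) hp
    linarith [Real.rpow_nonneg hl p]

lemma integrable_sqrt {Ω : Type*} [MeasurableSpace Ω] {μ : Measure Ω} [IsFiniteMeasure μ]
    {f : Ω → ℝ} (hfm : Measurable f) (hf0 : ∀ x, 0 ≤ f x) (hf : Integrable f μ) :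
    Integrable (fun x => √(f x)) μ := by
  refine ((integrable_const (1 : ℝ)).add hf).mono' hfm.sqrt.aestronglyMeasurable
    (ae_of_all _ fun x => ?_)
  rw [Real.norm_of_nonneg (Real.sqrt_nonneg _), Real.sqrt_le_left (by simp; linarith [hf0 x])]
  simp only [Pi.add_apply]
  nlinarith [hf0 x]

lemma pi_withDensity_ofReal {Ω ι : Type*} [MeasurableSpace Ω] [Fintype ι] (μ : Measure Ω)
    [SigmaFinite μ] {f : Ω → ℝ} (hf0 : ∀ x, 0 ≤ f x) (hf : Integrable f μ) :
    Measure.pi (fun _ : ι => μ.withDensity fun x => ENNReal.ofReal (f x))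
      = (Measure.pi fun _ : ι => μ).withDensity fun x => ENNReal.ofReal (∏ i, f (x i)) := by
  refine Measure.pi_eq fun s hs => ?_
  rw [withDensity_apply _ (MeasurableSet.univ_pi hs), Measure.restrict_pi_pi,
    ← ofReal_integral_eq_lintegral_ofReal
      (Integrable.fintype_prod (f := fun _ => f) fun i => hf.restrict)
      (ae_of_all _ fun x => Finset.prod_nonneg fun i _ => hf0 _),
    integral_fintype_prod_eq_prod (fun _ => f),
    ENNReal.ofReal_prod_of_nonneg fun i _ => integral_nonneg hf0]
  refine Finset.prod_congr rfl fun i _ => ?_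
  rw [withDensity_apply _ (hs i),
    ofReal_integral_eq_lintegral_ofReal hf.restrict (ae_of_all _ hf0)]

/-- A Hellinger bound for the difference between a probability measure and a reweighting of it. -/
lemma abs_measure_sub_withDensity_le {Ω : Type*} [MeasurableSpace Ω] (μ : Measure Ω)
    [IsProbabilityMeasure μ] {f : Ω → ℝ} (hfm : Measurable f) (hf0 : ∀ x, 0 ≤ f x)
    (hf : Integrable f μ) (hf1 : ∫ x, f x ∂μ = 1) {D : ℝ} (hD : 0 < D)
    (h : 1 - D ≤ ∫ x, √(f x) ∂μ) {A : Set Ω} (hA : MeasurableSet A) :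
    |(μ A).toReal - ((μ.withDensity fun x => ENNReal.ofReal (f x)) A).toReal| ≤ 3 * √D := by
  have hs := integrable_sqrt hfm hf0 hf
  set t := √D with ht
  have ht0 : 0 < t := Real.sqrt_pos.mpr hD
  have htD : D = t * t := (Real.mul_self_sqrt hD.le).symm
  have hpt (x : Ω) : |1 - f x| ≤ (1 + f x - 2 * √(f x)) / (2 * t) + t * (1 + f x) := by
    have hu := Real.sqrt_nonneg (f x)
    have hfu : f x = √(f x) ^ 2 := (Real.sq_sqrt (hf0 x)).symm
    set u := √(f x)
    rw [hfu, ← sub_nonneg]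
    have habs : |1 - u ^ 2| = |u - 1| * (u + 1) := by
      rw [← abs_of_nonneg (by linarith : 0 ≤ u + 1), ← abs_mul, abs_sub_comm]
      congr 1
      ring
    have : (1 + u ^ 2 - 2 * u) / (2 * t) + t * (1 + u ^ 2) - |1 - u ^ 2|
        = ((|u - 1| - t * (u + 1)) ^ 2 + t ^ 2 * (u - 1) ^ 2) / (2 * t) := by
      rw [habs]
      have := sq_abs (u - 1)
      field_simp
      linear_combination (-1 : ℝ) * this
    rw [this]
    positivity
  have hint : Integrable (fun x => (1 + f x - 2 * √(f x)) / (2 * t) + t * (1 + f x)) μ := by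
    fun_prop
  have hval : ∫ x, ((1 + f x - 2 * √(f x)) / (2 * t) + t * (1 + f x)) ∂μ
      = (2 - 2 * ∫ x, √(f x) ∂μ) / (2 * t) + t * 2 := by
    rw [integral_add (by fun_prop) (by fun_prop), integral_div, integral_sub (by fun_prop)
      (by fun_prop), integral_const_mul, integral_const_mul, integral_add (by fun_prop) hf, hf1]
    norm_num
  have hν : ((μ.withDensity fun x => ENNReal.ofReal (f x)) A).toReal = ∫ x in A, f x ∂μ := by
    rw [withDensity_apply _ hA, integral_eq_lintegral_of_nonneg_ae (ae_of_all _ hf0)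
      hfm.aestronglyMeasurable]
  have hμ : (μ A).toReal = ∫ x in A, (1 : ℝ) ∂μ := by simp [Measure.real]
  rw [hν, hμ, ← integral_sub (by fun_prop) hf.restrict]
  calc |∫ x in A, (1 - f x) ∂μ| ≤ ∫ x in A, |1 - f x| ∂μ := abs_integral_le_integral_abs
    _ ≤ ∫ x, |1 - f x| ∂μ :=
      setIntegral_le_integral (by fun_prop) (ae_of_all _ fun x => abs_nonneg _)
    _ ≤ _ := integral_mono (by fun_prop) hint hpt
    _ = _ := hval
    _ ≤ D / t + t * 2 := by
      have : (2 - 2 * ∫ x, √(f x) ∂μ) / (2 * t) = (1 - ∫ x, √(f x) ∂μ) / t := by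
        field_simp
      rw [this]
      gcongr
      linarith
    _ = 3 * t := by rw [htD]; field_simp; ring

lemma abs_pi_sub_pi_withDensity_le {Ω : Type*} [MeasurableSpace Ω] (μ : Measure Ω)
    [IsProbabilityMeasure μ] {f : Ω → ℝ} (hfm : Measurable f) (hf0 : ∀ x, 0 ≤ f x)
    (hf : Integrable f μ) (hf1 : ∫ x, f x ∂μ = 1) {n : ℕ} {d D : ℝ} (hD : 0 < D) (hnd : n * d ≤ D)
    (h : 1 - d ≤ ∫ x, √(f x) ∂μ) {A : Set (Fin n → Ω)} (hA : MeasurableSet A) :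
    |(Measure.pi (fun _ => μ) A).toReal
      - (Measure.pi (fun _ => μ.withDensity fun x => ENNReal.ofReal (f x)) A).toReal|
      ≤ 3 * √D := by
  rw [pi_withDensity_ofReal μ hf0 hf]
  refine abs_measure_sub_withDensity_le _ (by fun_prop)
    (fun x => Finset.prod_nonneg fun i _ => hf0 _)
    (Integrable.fintype_prod (f := fun _ => f) fun i => hf) ?_ hD ?_ hA
  · rw [integral_fintype_prod_eq_pow, hf1, one_pow]
  · simp_rw [Real.sqrt_prod _ fun i _ => hf0 _]
    rw [integral_fintype_prod_eq_pow (fun x => √(f x)), Fintype.card_fin]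
    have h0 : 0 ≤ ∫ x, √(f x) ∂μ := integral_nonneg fun x => Real.sqrt_nonneg _
    have := one_add_mul_le_pow (a := ∫ x, √(f x) ∂μ - 1) (by linarith) n
    rw [add_sub_cancel] at this
    nlinarith [(Nat.cast_nonneg n : (0 : ℝ) ≤ n)]

instance : IsProbabilityMeasure stdGauss := by unfold stdGauss; infer_instance

instance : IsProbabilityMeasure stdGauss2 := by unfold stdGauss2; infer_instance

lemma measurable_biNormal_map (ρ : ℝ) :
    Measurable fun z : ℝ × ℝ => (z.1, ρ * z.1 + √(1 - ρ ^ 2) * z.2) := by fun_prop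

instance (ρ : ℝ) : IsProbabilityMeasure (biNormal ρ) :=
  Measure.isProbabilityMeasure_map (measurable_biNormal_map ρ).aemeasurable

lemma biNormal_zero : biNormal 0 = stdGauss2 := by simp [biNormal]

/-- The likelihood ratio of `N(0, Σ_ρ)` with respect to `N(0, Σ_0)`. -/
def likelihoodRatio (ρ : ℝ) (z : ℝ × ℝ) : ℝ :=
  (√(1 - ρ ^ 2))⁻¹ * rexp (z.1 ^ 2 / 2 - (z.1 - ρ * z.2) ^ 2 / (2 * (1 - ρ ^ 2)))

lemma measurable_likelihoodRatio (ρ : ℝ) : Measurable (likelihoodRatio ρ) := by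
  unfold likelihoodRatio; fun_prop

lemma likelihoodRatio_nonneg (ρ : ℝ) (z : ℝ × ℝ) : 0 ≤ likelihoodRatio ρ z := by
  unfold likelihoodRatio; positivity

lemma likelihoodRatio_le {ρ : ℝ} (hρ : ρ ^ 2 < 1) (z : ℝ × ℝ) :
    likelihoodRatio ρ z ≤ (√(1 - ρ ^ 2))⁻¹ * rexp (z.1 ^ 2 / 2) := by
  unfold likelihoodRatio
  gcongr
  have : 0 < 1 - ρ ^ 2 := by linarith
  linarith [show 0 ≤ (z.1 - ρ * z.2) ^ 2 / (2 * (1 - ρ ^ 2)) by positivity]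

lemma gaussianReal_eq_withDensity_likelihoodRatio {ρ : ℝ} (hρ : ρ ^ 2 < 1) (x : ℝ) :
    gaussianReal (ρ * x) (Real.toNNReal (1 - ρ ^ 2))
      = stdGauss.withDensity fun y => ENNReal.ofReal (likelihoodRatio ρ (x, y)) := by
  have h0 : 0 < 1 - ρ ^ 2 := by linarith
  have hm : Measurable fun y => ENNReal.ofReal (likelihoodRatio ρ (x, y)) :=
    ((measurable_likelihoodRatio ρ).comp measurable_prodMk_left).ennreal_ofReal
  rw [gaussianReal_of_var_ne_zero _ (by simpa using h0), stdGauss,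
    gaussianReal_of_var_ne_zero _ one_ne_zero,
    ← withDensity_mul _ (measurable_gaussianPDF _ _) hm]
  congr 1
  ext y
  rw [Pi.mul_apply, gaussianPDF, gaussianPDF, ← ENNReal.ofReal_mul (gaussianPDFReal_nonneg _ _ _)]
  congr 1
  rw [gaussianPDFReal, gaussianPDFReal, likelihoodRatio, Real.coe_toNNReal _ h0.le,
    Real.sqrt_mul (by positivity), mul_inv, NNReal.coe_one, mul_one,
    mul_mul_mul_comm, ← Real.exp_add]
  congr 2
  field_simp
  ring

lemma biNormal_eq_withDensity {ρ : ℝ} (hρ : ρ ^ 2 < 1) :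
    biNormal ρ = stdGauss2.withDensity fun z => ENNReal.ofReal (likelihoodRatio ρ z) := by
  have hL := (measurable_likelihoodRatio ρ).ennreal_ofReal
  ext S hS
  rw [biNormal, Measure.map_apply (measurable_biNormal_map ρ) hS, withDensity_apply _ hS,
    stdGauss2, Measure.prod_apply (measurable_biNormal_map ρ hS), ← lintegral_indicator hS,
    lintegral_prod _ (hL.indicator hS).aemeasurable]
  refine lintegral_congr fun x => ?_
  have hSx : MeasurableSet (Prod.mk x ⁻¹' S) := measurable_prodMk_left hS
  have hmap : stdGauss.map (fun y => ρ * x + √(1 - ρ ^ 2) * y)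
      = gaussianReal (ρ * x) (Real.toNNReal (1 - ρ ^ 2)) := by
    have : (fun y => ρ * x + √(1 - ρ ^ 2) * y)
        = (fun y => ρ * x + y) ∘ fun y => √(1 - ρ ^ 2) * y := rfl
    rw [this, ← Measure.map_map (by fun_prop) (by fun_prop), stdGauss,
      gaussianReal_map_const_mul, gaussianReal_map_const_add]
    congr 1
    · ring
    · ext
      simp [Real.sq_sqrt (by linarith : 0 ≤ 1 - ρ ^ 2), (by linarith : ρ ^ 2 ≤ 1)]
  calc stdGauss (Prod.mk x ⁻¹' ((fun z : ℝ × ℝ => (z.1, ρ * z.1 + √(1 - ρ ^ 2) * z.2)) ⁻¹' S))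
      = stdGauss.map (fun y => ρ * x + √(1 - ρ ^ 2) * y) (Prod.mk x ⁻¹' S) :=
        (Measure.map_apply (by fun_prop) hSx).symm
    _ = ∫⁻ y in Prod.mk x ⁻¹' S, ENNReal.ofReal (likelihoodRatio ρ (x, y)) ∂stdGauss := by
        rw [hmap, gaussianReal_eq_withDensity_likelihoodRatio hρ, withDensity_apply _ hSx]
    _ = _ := by
        rw [← lintegral_indicator hSx]
        rfl

lemma integrable_likelihoodRatio {ρ : ℝ} (hρ : ρ ^ 2 < 1) :
    Integrable (likelihoodRatio ρ) stdGauss2 := by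
  refine ⟨(measurable_likelihoodRatio ρ).aestronglyMeasurable, ?_⟩
  rw [hasFiniteIntegral_iff_ofReal (ae_of_all _ (likelihoodRatio_nonneg ρ)), ← setLIntegral_univ,
    ← withDensity_apply _ MeasurableSet.univ, ← biNormal_eq_withDensity hρ]
  exact measure_lt_top _ _

lemma integral_likelihoodRatio {ρ : ℝ} (hρ : ρ ^ 2 < 1) :
    ∫ z, likelihoodRatio ρ z ∂stdGauss2 = 1 := by
  rw [integral_eq_lintegral_of_nonneg_ae (ae_of_all _ (likelihoodRatio_nonneg ρ))
    (measurable_likelihoodRatio ρ).aestronglyMeasurable, ← setLIntegral_univ,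
    ← withDensity_apply _ MeasurableSet.univ, ← biNormal_eq_withDensity hρ, measure_univ,
    ENNReal.toReal_one]

lemma integrable_exp_mul_sq_stdGauss {a : ℝ} (ha : a < 1) :
    Integrable (fun x => rexp (a * (x ^ 2 / 2))) stdGauss := by
  rw [stdGauss, gaussianReal_of_var_ne_zero _ one_ne_zero, gaussianPDF_def,
    integrable_withDensity_iff (by fun_prop) (by simp)]
  refine ((integrable_exp_neg_mul_sq (b := (1 - a) / 2) (by linarith)).const_mul
    (√(2 * π))⁻¹).congr (ae_of_all _ fun x => ?_)
  simp only [ENNReal.toReal_ofReal (gaussianPDFReal_nonneg 0 1 x)]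
  simp only [gaussianPDFReal, NNReal.coe_one, mul_one, sub_zero]
  rw [mul_left_comm, ← Real.exp_add]
  congr 2
  ring

lemma lintegral_likelihoodRatio_rpow_le {ρ p : ℝ} (hρ : ρ ^ 2 < 1) (hp1 : 1 ≤ p) (hp2 : p < 2) :
    ∫⁻ z, ENNReal.ofReal (likelihoodRatio ρ z ^ p) ∂stdGauss2
      ≤ ENNReal.ofReal (√(1 - ρ ^ 2) ^ (1 - p)
        * ∫ x, rexp ((p - 1) * (x ^ 2 / 2)) ∂stdGauss) := by
  have hm := measurable_likelihoodRatio ρ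
  have hs : 0 < √(1 - ρ ^ 2) := Real.sqrt_pos.mpr (by linarith)
  calc ∫⁻ z, ENNReal.ofReal (likelihoodRatio ρ z ^ p) ∂stdGauss2
      = ∫⁻ z, ENNReal.ofReal (likelihoodRatio ρ z ^ (p - 1)) ∂biNormal ρ := by
        rw [biNormal_eq_withDensity hρ, lintegral_withDensity_eq_lintegral_mul _
          hm.ennreal_ofReal (hm.pow_const _).ennreal_ofReal]
        refine lintegral_congr fun z => ?_
        have hz : 0 < likelihoodRatio ρ z := by
          unfold likelihoodRatio; positivity
        rw [Pi.mul_apply, ← ENNReal.ofReal_mul hz.le, Real.rpow_sub_one hz.ne']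
        congr 1
        field_simp
    _ ≤ ∫⁻ z, ENNReal.ofReal (√(1 - ρ ^ 2) ^ (1 - p) * rexp ((p - 1) * (z.1 ^ 2 / 2)))
          ∂biNormal ρ := by
        refine lintegral_mono fun z => ENNReal.ofReal_le_ofReal ?_
        calc likelihoodRatio ρ z ^ (p - 1)
            ≤ ((√(1 - ρ ^ 2))⁻¹ * rexp (z.1 ^ 2 / 2)) ^ (p - 1) :=
              Real.rpow_le_rpow (likelihoodRatio_nonneg _ _) (likelihoodRatio_le hρ z)
                (by linarith)
          _ = _ := by
              rw [Real.mul_rpow (by positivity) (by positivity), ← Real.rpow_neg_one,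
                ← Real.rpow_mul hs.le, ← Real.exp_mul]
              congr 2 <;> ring
    _ = ∫⁻ z, ENNReal.ofReal (√(1 - ρ ^ 2) ^ (1 - p) * rexp ((p - 1) * (z.1 ^ 2 / 2)))
          ∂stdGauss2 := by
        rw [biNormal, lintegral_map (by fun_prop) (measurable_biNormal_map ρ)]
    _ = ∫⁻ x, ENNReal.ofReal (√(1 - ρ ^ 2) ^ (1 - p) * rexp ((p - 1) * (x ^ 2 / 2)))
          ∂stdGauss := by
        rw [stdGauss2, lintegral_prod _ (by fun_prop)]
        simp
    _ = _ := by
        rw [← integral_const_mul, ofReal_integral_eq_lintegral_ofReal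
          ((integrable_exp_mul_sq_stdGauss (by linarith)).const_mul _)
          (ae_of_all _ fun x => by positivity)]

lemma integrable_likelihoodRatio_rpow {ρ p : ℝ} (hρ : ρ ^ 2 < 1) (hp1 : 1 ≤ p) (hp2 : p < 2) :
    Integrable (fun z => likelihoodRatio ρ z ^ p) stdGauss2 := by
  refine ⟨((measurable_likelihoodRatio ρ).pow_const _).aestronglyMeasurable, ?_⟩
  rw [hasFiniteIntegral_iff_ofReal
    (ae_of_all _ fun z => Real.rpow_nonneg (likelihoodRatio_nonneg ρ z) p)]
  exact (lintegral_likelihoodRatio_rpow_le hρ hp1 hp2).trans_lt ENNReal.ofReal_lt_top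

lemma integral_likelihoodRatio_rpow_le {ρ p : ℝ} (hρ : ρ ^ 2 < 1) (hp1 : 1 ≤ p) (hp2 : p < 2) :
    ∫ z, likelihoodRatio ρ z ^ p ∂stdGauss2
      ≤ √(1 - ρ ^ 2) ^ (1 - p) * ∫ x, rexp ((p - 1) * (x ^ 2 / 2)) ∂stdGauss := by
  rw [integral_eq_lintegral_of_nonneg_ae
    (ae_of_all _ fun z => Real.rpow_nonneg (likelihoodRatio_nonneg ρ z) p)
    ((measurable_likelihoodRatio ρ).pow_const _).aestronglyMeasurable]
  refine ENNReal.toReal_le_of_le_ofReal ?_ (lintegral_likelihoodRatio_rpow_le hρ hp1 hp2)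
  have : 0 ≤ ∫ x, rexp ((p - 1) * (x ^ 2 / 2)) ∂stdGauss :=
    integral_nonneg fun x => (Real.exp_pos _).le
  positivity

/-- The likelihood ratio of the contamination mixture with respect to the null. -/
lemma mixture_eq_withDensity {ε ρ : ℝ} (hε0 : 0 ≤ ε) (hε1 : ε ≤ 1) (hρ : ρ ^ 2 < 1) :
    mixture ε ρ
      = stdGauss2.withDensity fun z => ENNReal.ofReal (1 + ε * (likelihoodRatio ρ z - 1)) := by
  have hm := (measurable_likelihoodRatio ρ).ennreal_ofReal
  have h1 : stdGauss2 = stdGauss2.withDensity fun _ => 1 := (withDensity_one).symm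
  rw [mixture, biNormal_zero, biNormal_eq_withDensity hρ]
  nth_rewrite 1 [h1]
  rw [← withDensity_smul _ measurable_const, ← withDensity_smul _ hm,
    ← withDensity_add_left (by fun_prop)]
  congr 1
  ext z
  have hL := likelihoodRatio_nonneg ρ z
  simp only [Pi.add_apply, Pi.smul_apply, smul_eq_mul, mul_one]
  rw [← ENNReal.ofReal_mul hε0, ← ENNReal.ofReal_add (by linarith) (by positivity)]
  congr 1
  ring

lemma abs_iid_sub_iid_mixture_le {ε ρ p D : ℝ} {n : ℕ} (hε0 : 0 ≤ ε) (hε1 : ε ≤ 1)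
    (hρ : ρ ^ 2 < 1) (hp1 : 1 ≤ p) (hp2 : p < 2) (hD : 0 < D)
    (hnD : n * (ε ^ p * (√(1 - ρ ^ 2) ^ (1 - p)
      * ∫ x, rexp ((p - 1) * (x ^ 2 / 2)) ∂stdGauss + 1)) ≤ D)
    {A : Set (Fin n → ℝ × ℝ)} (hA : MeasurableSet A) :
    |(iid n (biNormal 0) A).toReal - (iid n (mixture ε ρ) A).toReal| ≤ 3 * √D := by
  have hL0 := likelihoodRatio_nonneg ρ
  have hLi := integrable_likelihoodRatio hρ
  have hLp := integrable_likelihoodRatio_rpow hρ hp1 hp2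
  have hm := measurable_likelihoodRatio ρ
  have hx (z) : -1 ≤ ε * (likelihoodRatio ρ z - 1) := by
    nlinarith [mul_nonneg hε0 (hL0 z)]
  have hf0 (z) : 0 ≤ 1 + ε * (likelihoodRatio ρ z - 1) := by linarith [hx z]
  have hfm : Measurable fun z => 1 + ε * (likelihoodRatio ρ z - 1) := by fun_prop
  have hfi : Integrable (fun z => 1 + ε * (likelihoodRatio ρ z - 1)) stdGauss2 := by fun_prop
  have hf1 : ∫ z, (1 + ε * (likelihoodRatio ρ z - 1)) ∂stdGauss2 = 1 := by
    rw [integral_add (by fun_prop) (by fun_prop), integral_const_mul,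
      integral_sub hLi (by fun_prop), integral_likelihoodRatio hρ]
    simp
  unfold iid
  rw [biNormal_zero, mixture_eq_withDensity hε0 hε1 hρ]
  refine abs_pi_sub_pi_withDensity_le stdGauss2 hfm hf0 hfi hf1 hD hnD ?_ hA
  calc _ ≤ 1 - ε ^ p * (∫ z, likelihoodRatio ρ z ^ p ∂stdGauss2 + 1) := by
        gcongr
        exact integral_likelihoodRatio_rpow_le hρ hp1 hp2
    _ = ∫ z, ((1 + ε * (likelihoodRatio ρ z - 1) + 1) / 2
          - ε ^ p * (likelihoodRatio ρ z ^ p + 1)) ∂stdGauss2 := by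
        rw [integral_sub (by fun_prop) (by fun_prop), integral_div,
          integral_add hfi (by fun_prop), hf1, integral_const_mul,
          integral_add hLp (by fun_prop)]
        simp
    _ ≤ _ := by
        refine integral_mono (by fun_prop) (integrable_sqrt hfm hf0 hfi) fun z => ?_
        have h1 := one_add_half_sub_le_sqrt (hx z) hp1 hp2.le
        have h2 := mul_le_mul_of_nonneg_left
          (abs_sub_one_rpow_le (hL0 z) (by linarith : 0 ≤ p)) (Real.rpow_nonneg hε0 p)
        rw [abs_mul, abs_of_nonneg hε0, Real.mul_rpow hε0 (abs_nonneg _)] at h1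
        linarith

lemma rpow_rate_le {β γ p K : ℝ} (hγ0 : 0 < γ) (hp1 : 1 ≤ p) (hK : 0 ≤ K) {n : ℕ} (hn : 1 ≤ n) :
    n * (((n : ℝ) ^ (-β)) ^ p * (√(1 - (1 - (n : ℝ) ^ (-γ)) ^ 2) ^ (1 - p) * K + 1))
      ≤ (K + 1) * (n : ℝ) ^ (1 - p * β + γ / 2 * (p - 1)) := by
  have hn1 : (1 : ℝ) ≤ n := by exact_mod_cast hn
  have hn0 : (0 : ℝ) < n := by linarith
  set q := (n : ℝ) ^ (-γ) with hq
  have hq0 : 0 < q := Real.rpow_pos_of_pos hn0 _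
  have hq1 : q ≤ 1 := Real.rpow_le_one_of_one_le_of_nonpos hn1 (by linarith)
  set w := (n : ℝ) ^ (γ / 2 * (p - 1)) with hw
  have hw1 : 1 ≤ w := Real.one_le_rpow hn1 (mul_nonneg (by linarith) (by linarith))
  have hsw : √(1 - (1 - q) ^ 2) ^ (1 - p) ≤ w := by
    calc √(1 - (1 - q) ^ 2) ^ (1 - p) ≤ √q ^ (1 - p) :=
          Real.rpow_le_rpow_of_nonpos (Real.sqrt_pos.mpr hq0)
            (Real.sqrt_le_sqrt (by nlinarith)) (by linarith)
      _ = w := by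
          rw [Real.sqrt_eq_rpow, hq, ← Real.rpow_mul hn0.le, ← Real.rpow_mul hn0.le, hw]
          congr 1
          ring
  calc _ ≤ n * (((n : ℝ) ^ (-β)) ^ p * (w * K + w)) := by gcongr
    _ = (K + 1) * ((n : ℝ) ^ (1 : ℝ) * (n : ℝ) ^ (-β * p) * w) := by
        rw [← Real.rpow_mul hn0.le, Real.rpow_one]; ring
    _ = _ := by
        rw [hw, ← Real.rpow_add hn0, ← Real.rpow_add hn0]
        congr 2
        ring

/-- A vanishing bound on the difference between the null and the alternative, uniform over
events. -/
lemma exists_tendsto_zero_bound {β γ : ℝ} (hβ0 : 1 / 2 < β) (hβ1 : β < 1) (hγ0 : 0 < γ)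
    (hsparse : γ < 4 * (β - 1 / 2))
    {ε ρ : ℕ → ℝ} (hε : ∀ n : ℕ, ε n = (n : ℝ) ^ (-β))
    (hρ : ∀ n : ℕ, ρ n = 1 - (n : ℝ) ^ (-γ)) :
    ∃ b : ℕ → ℝ, Tendsto b atTop (𝓝 0) ∧ ∀ n, 2 ≤ n → 0 ≤ b n ∧
      ∀ A : Set (Fin n → ℝ × ℝ), MeasurableSet A →
        |(iid n (biNormal 0) A).toReal - (iid n (mixture (ε n) (ρ n)) A).toReal| ≤ b n := by
  obtain ⟨p, hp1, hp2, he⟩ : ∃ p : ℝ, 1 ≤ p ∧ p < 2 ∧ 1 - p * β + γ / 2 * (p - 1) < 0 := by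
    refine ⟨2 - (2 * β - 1 - γ / 2) / 2, by linarith, by linarith, ?_⟩
    nlinarith [mul_pos (by linarith : 0 < 2 * β - 1 - γ / 2) (by linarith : 0 < 1 - β + γ / 2)]
  set K := ∫ x, rexp ((p - 1) * (x ^ 2 / 2)) ∂stdGauss
  have hK : 0 ≤ K := integral_nonneg fun x => (Real.exp_pos _).le
  set e := 1 - p * β + γ / 2 * (p - 1)
  refine ⟨fun n => 3 * √((K + 1) * (n : ℝ) ^ e), ?_, fun n hn => ⟨by positivity, fun A hA => ?_⟩⟩
  · have h1 : Tendsto (fun n : ℕ => (n : ℝ) ^ e) atTop (𝓝 0) := by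
      have := (tendsto_rpow_neg_atTop (y := -e) (by linarith)).comp
        (tendsto_natCast_atTop_atTop (R := ℝ))
      simpa [Function.comp_def] using this
    have h2 := ((h1.const_mul (K + 1)).sqrt).const_mul 3
    simpa using h2
  · have hn1 : (1 : ℝ) < n := by exact_mod_cast hn
    have hn0 : (0 : ℝ) < n := by linarith
    have hq0 : 0 < (n : ℝ) ^ (-γ) := Real.rpow_pos_of_pos hn0 _
    have hq1 : (n : ℝ) ^ (-γ) ≤ 1 := Real.rpow_le_one_of_one_le_of_nonpos hn1.le (by linarith)
    refine abs_iid_sub_iid_mixture_le (p := p) ?_ ?_ ?_ hp1 hp2 (by positivity) ?_ hA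
    · rw [hε]; positivity
    · rw [hε]; exact Real.rpow_le_one_of_one_le_of_nonpos hn1.le (by linarith)
    · rw [hρ]; nlinarith
    · rw [hε, hρ]; exact rpow_rate_le hγ0 hp1 hK (by omega)

/-- in the sparse regime with `γ < 4(β - 1/2)`, the total variation distance
between the `n`-fold products of the null and the alternative tends to 0, and every
sequence of tests (given by rejection regions `A n`) is asymptotically powerless. -/
theorem sparse_regime_LRT_powerless (β γ : ℝ) (hβ0 : 1 / 2 < β) (hβ1 : β < 1) (hγ0 : 0 < γ)
    (hsparse : γ < 4 * (β - 1 / 2))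
    (ε ρ : ℕ → ℝ) (hε : ∀ n : ℕ, ε n = (n : ℝ) ^ (-β))
    (hρ : ∀ n : ℕ, ρ n = 1 - (n : ℝ) ^ (-γ)) :
    Tendsto (fun n => tvDist (iid n (biNormal 0)) (iid n (mixture (ε n) (ρ n)))) atTop (𝓝 0)
    ∧ ∀ A : (n : ℕ) → Set (Fin n → ℝ × ℝ), (∀ n, MeasurableSet (A n)) →
        1 ≤ Filter.liminf (fun n =>
          ((iid n (biNormal 0)) (A n)).toReal
            + (1 - ((iid n (mixture (ε n) (ρ n))) (A n)).toReal)) atTop := by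
  obtain ⟨b, hb, hbound⟩ := exists_tendsto_zero_bound hβ0 hβ1 hγ0 hsparse hε hρ
  constructor
  · refine squeeze_zero' (Eventually.of_forall fun n => Real.iSup_nonneg fun s => abs_nonneg _)
      ?_ hb
    filter_upwards [eventually_ge_atTop 2] with n hn
    exact Real.iSup_le (fun s => (hbound n hn).2 s.1 s.2) (hbound n hn).1
  · intro A hA
    have hdiff : Tendsto (fun n => (iid n (biNormal 0) (A n)).toReal
        - (iid n (mixture (ε n) (ρ n)) (A n)).toReal) atTop (𝓝 0) := by
      refine squeeze_zero_norm' ?_ hb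
      filter_upwards [eventually_ge_atTop 2] with n hn
      exact (hbound n hn).2 (A n) (hA n)
    have hlim := hdiff.const_add 1
    rw [add_zero] at hlim
    refine (Tendsto.liminf_eq (hlim.congr fun n => ?_)).ge
    ring
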